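/- Let d ≥ 3 and 0 ≤ m ≤ d. For all x, y in U_m = ℕ₀^m × ℤ^{d−m} (with nearest-neighbor edges and unit conductances), the Green's function of the simple random walk on U_m satisfies G_m(x, y) = Σ_{v ∈ {0,1}^m × {0}^{d−m}} g( x, ((−1)^{v_i}(y_i + 1/2) − 1/2)_{i=1}^d ), where g is the Green's function of the simple random walk on ℤ^d. (Note that for each v the point ((−1)^{v_i}(y_i + 1/2) − 1/2)_{i=1}^d lies in ℤ^d: its i-th coordinate is y_i if v_i = 0 and −y_i − 1 if v_i = 1.) -/

import Mathlib

open scoped ENNReal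
open Filter

noncomputable section

variable {V : Type*}

/-- Total conductance (weight) `π(x) = Σ_y c(x,y)` at a vertex `x`. -/
def piW (c : V → V → ℝ≥0∞) (x : V) : ℝ≥0∞ := ∑' y, c x y

/-- One-step transition probability `c(x,y)/π(x)` of the random walk with conductances `c`. -/
def step (c : V → V → ℝ≥0∞) (x y : V) : ℝ≥0∞ := c x y / piW c x

/-- `n`-step transition probability of the random walk with conductances `c`. -/
def stepN [DecidableEq V] (c : V → V → ℝ≥0∞) : ℕ → V → V → ℝ≥0∞
  | 0, x, y => if x = y then 1 else 0
  | n + 1, x, y => ∑' z, stepN c n x z * step c z y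

/-- Green's function `G(x,y) = π(y)⁻¹ Σ_n p_n(x,y)` of the walk with conductances `c`. -/
def green [DecidableEq V] (c : V → V → ℝ≥0∞) (x y : V) : ℝ≥0∞ :=
  (piW c y)⁻¹ * ∑' n, stepN c n x y

/-- Nearest-neighbour adjacency on `ℤ^d`. -/
def latAdj {d : ℕ} (x y : Fin d → ℤ) : Prop := (∑ i, (x i - y i).natAbs) = 1

instance {d : ℕ} (x y : Fin d → ℤ) : Decidable (latAdj x y) := by
  unfold latAdj; infer_instance

/-- Unit conductances on `ℤ^d`. -/
def cZ (d : ℕ) (x y : Fin d → ℤ) : ℝ≥0∞ := if latAdj x y then 1 else 0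

/-- Green's function of the simple random walk on `ℤ^d`. -/
def g (d : ℕ) : (Fin d → ℤ) → (Fin d → ℤ) → ℝ≥0∞ := green (cZ d)

/-- Membership in `U_m = ℕ₀^m × ℤ^{d-m}`: the first `m` coordinates are nonnegative. -/
def memU (m : ℕ) {d : ℕ} (x : Fin d → ℤ) : Prop := ∀ i : Fin d, (i : ℕ) < m → 0 ≤ x i

instance (m : ℕ) {d : ℕ} (x : Fin d → ℤ) : Decidable (memU m x) := by
  unfold memU; infer_instance

/-- Unit conductances on the subgraph `U_m` of `ℤ^d`. -/
def cU (d m : ℕ) (x y : Fin d → ℤ) : ℝ≥0∞ :=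
  if memU m x ∧ memU m y ∧ latAdj x y then 1 else 0

/-- Green's function `G_m` of the simple random walk on `U_m = ℕ₀^m × ℤ^{d-m}`. -/
def Gm (d m : ℕ) : (Fin d → ℤ) → (Fin d → ℤ) → ℝ≥0∞ := green (cU d m)

/-- Reflection in the first coordinate: `ȳ = (-y₁, y₂, …, y_d)`. -/
def reflFirst {d : ℕ} (y : Fin d → ℤ) : Fin d → ℤ := fun i => if (i : ℕ) = 0 then -y i else y i

/-- The first standard basis vector of `ℤ^d`. -/
def e1 (d : ℕ) : Fin d → ℤ := fun i => if (i : ℕ) = 0 then 1 else 0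


section Network

/-- Network automorphisms preserve the total conductance at a vertex. -/
lemma piW_equiv {c : V → V → ℝ≥0∞} (σ : V ≃ V) (hσ : ∀ x y, c (σ x) (σ y) = c x y) (x : V) :
    piW c (σ x) = piW c x := by
  simp only [piW]
  rw [← σ.tsum_eq]
  simp only [hσ]

variable [DecidableEq V] (c : V → V → ℝ≥0∞)

/-- Green's function solves the Poisson equation with a point source. -/
lemma green_mul_piW (x y : V) (h0 : piW c y ≠ 0) (ht : piW c y ≠ ⊤) :
    green c x y * piW c y = (if x = y then 1 else 0) + ∑' z, green c x z * c z y := by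
  have hG : green c x y * piW c y = ∑' n, stepN c n x y := by
    rw [green, mul_comm, ← mul_assoc, ENNReal.mul_inv_cancel h0 ht, one_mul]
  rw [hG, tsum_eq_zero_add' ENNReal.summable]
  congr 1
  simp only [stepN]
  rw [ENNReal.tsum_comm]
  refine tsum_congr fun z => ?_
  rw [ENNReal.tsum_mul_right, green, step, div_eq_mul_inv]
  ring

/-- A supersolution of the Poisson equation with finitely many point sources dominates the sum of
the corresponding Green's functions. -/
lemma sum_green_le {ι : Type*} (s : Finset ι) (p : ι → V) (u : V → ℝ≥0∞)
    (hu : ∀ y, ∑ i ∈ s, (if p i = y then 1 else 0) + ∑' z, u z * c z y ≤ u y * piW c y) (y : V) :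
    ∑ i ∈ s, green c (p i) y ≤ u y := by
  have key : ∀ (N : ℕ) (y : V),
      ∑ n ∈ Finset.range N, ∑ i ∈ s, stepN c n (p i) y ≤ u y * piW c y := by
    intro N
    induction N with
    | zero => intro y; simp
    | succ N ih =>
      intro y
      refine le_trans ?_ (hu y)
      rw [Finset.sum_range_succ', add_comm]
      refine add_le_add le_rfl ?_
      calc ∑ n ∈ Finset.range N, ∑ i ∈ s, stepN c (n + 1) (p i) y
          = ∑' z, (∑ n ∈ Finset.range N, ∑ i ∈ s, stepN c n (p i) z) * step c z y := by
            simp only [stepN, Finset.sum_mul]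
            rw [Summable.tsum_finsetSum fun _ _ => ENNReal.summable]
            refine Finset.sum_congr rfl fun n _ => ?_
            rw [Summable.tsum_finsetSum fun _ _ => ENNReal.summable]
        _ ≤ ∑' z, u z * c z y := by
            refine ENNReal.tsum_le_tsum fun z => ?_
            calc _ ≤ u z * piW c z * step c z y := mul_le_mul_left (ih z) _
              _ = u z * (piW c z * (c z y / piW c z)) := by rw [step, mul_assoc]
              _ ≤ u z * c z y := mul_le_mul_right ENNReal.mul_div_le _
  have hsum : ∑ i ∈ s, green c (p i) y = (piW c y)⁻¹ * ∑' n, ∑ i ∈ s, stepN c n (p i) y := by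
    simp only [green]
    rw [← Finset.mul_sum, Summable.tsum_finsetSum fun _ _ => ENNReal.summable]
  have htot : ∑' n, ∑ i ∈ s, stepN c n (p i) y ≤ u y * piW c y := by
    rw [ENNReal.tsum_eq_iSup_nat]
    exact iSup_le fun N => key N y
  calc _ ≤ (piW c y)⁻¹ * (u y * piW c y) := hsum ▸ mul_le_mul_right htot _
    _ = u y * (piW c y * (piW c y)⁻¹) := by ring
    _ ≤ u y * 1 := mul_le_mul_right (ENNReal.mul_inv_le_one _) _
    _ = u y := mul_one _

/-- Network automorphisms preserve Green's function. -/
lemma green_equiv {c : V → V → ℝ≥0∞} (σ : V ≃ V) (hσ : ∀ x y, c (σ x) (σ y) = c x y) (x y : V) :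
    green c (σ x) (σ y) = green c x y := by
  have h : ∀ (n : ℕ) (y : V), stepN c n (σ x) (σ y) = stepN c n x y := by
    intro n
    induction n with
    | zero => intro y; simp [stepN]
    | succ n ih =>
      intro y
      simp only [stepN]
      rw [← σ.tsum_eq]
      simp only [ih, step, hσ, piW_equiv σ hσ]
  simp only [green, h, piW_equiv σ hσ]

end Network

section Lattice

variable {d : ℕ}

lemma latAdj_comm (x y : Fin d → ℤ) : latAdj x y ↔ latAdj y x := by
  have h : ∀ i, (x i - y i).natAbs = (y i - x i).natAbs := fun i => by omega
  simp only [latAdj, h]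

lemma cZ_comm (x y : Fin d → ℤ) : cZ d x y = cZ d y x := by
  simp only [cZ, latAdj_comm x y]

lemma cU_comm (m : ℕ) (x y : Fin d → ℤ) : cU d m x y = cU d m y x := by
  simp only [cU, latAdj_comm x y]
  congr 1
  exact propext (by tauto)

/-- Reflection `y_i ↦ -y_i - 1` in the coordinates selected by `v`. -/
def reflect (v : Fin d → Bool) : (Fin d → ℤ) ≃ (Fin d → ℤ) :=
  Function.Involutive.toPerm (fun y i => if v i then -y i - 1 else y i) fun y => by
    funext i
    by_cases h : v i <;> simp [h]

lemma reflect_apply (v : Fin d → Bool) (y : Fin d → ℤ) (i : Fin d) :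
    reflect v y i = if v i then -y i - 1 else y i := rfl

lemma reflect_reflect (v w : Fin d → Bool) (y : Fin d → ℤ) :
    reflect v (reflect w y) = reflect (fun i => xor (v i) (w i)) y := by
  funext i
  simp only [reflect_apply]
  cases v i <;> cases w i <;> simp

lemma reflect_reflect_self (v : Fin d → Bool) (y : Fin d → ℤ) : reflect v (reflect v y) = y := by
  funext i
  simp only [reflect_apply]
  cases v i <;> simp

lemma latAdj_reflect (v : Fin d → Bool) (x y : Fin d → ℤ) :
    latAdj (reflect v x) (reflect v y) ↔ latAdj x y := by
  have h : ∀ i, (reflect v x i - reflect v y i).natAbs = (x i - y i).natAbs := fun i => by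
    simp only [reflect_apply]
    split <;> omega
  simp only [latAdj, h]

lemma cZ_reflect (v : Fin d → Bool) (x y : Fin d → ℤ) :
    cZ d (reflect v x) (reflect v y) = cZ d x y := by
  simp only [cZ, latAdj_reflect]

lemma g_reflect (v : Fin d → Bool) (x y : Fin d → ℤ) :
    g d x (reflect v y) = g d (reflect v x) y := by
  rw [g, ← green_equiv (reflect v) (cZ_reflect v) x, reflect_reflect_self]

/-- The coordinates among the first `m` in which `y` is negative. -/
def negCoords (m : ℕ) (y : Fin d → ℤ) : Fin d → Bool := fun i => decide ((i : ℕ) < m ∧ y i < 0)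

/-- The folding map of `ℤ^d` onto `ℕ₀^m × ℤ^{d-m}`. -/
def fold (m : ℕ) (y : Fin d → ℤ) : Fin d → ℤ := reflect (negCoords m y) y

lemma fold_apply (m : ℕ) (y : Fin d → ℤ) (i : Fin d) :
    fold m y i = if (i : ℕ) < m ∧ y i < 0 then -y i - 1 else y i := by
  simp [fold, reflect_apply, negCoords]

lemma memU_fold (m : ℕ) (y : Fin d → ℤ) : memU m (fold m y) := by
  intro i hi
  rw [fold_apply]
  split <;> omega

lemma fold_eq_self {m : ℕ} {y : Fin d → ℤ} (hy : memU m y) : fold m y = y := by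
  funext i
  have := hy i
  rw [fold_apply]
  split <;> omega

lemma fold_reflect {m : ℕ} {v : Fin d → Bool} (hv : ∀ i : Fin d, m ≤ (i : ℕ) → v i = false)
    (y : Fin d → ℤ) : fold m (reflect v y) = fold m y := by
  funext i
  have := hv i
  simp only [fold_apply, reflect_apply]
  by_cases h : v i = true
  · have : (i : ℕ) < m := by by_contra h'; simp_all
    simp only [h, if_true, this, true_and]
    split <;> split <;> omega
  · simp [h]

lemma negCoords_eq_false {m : ℕ} (y : Fin d → ℤ) (i : Fin d) (hi : m ≤ (i : ℕ)) :
    negCoords m y i = false := by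
  simp [negCoords, hi]

/-- Sign patterns supported on the first `m` coordinates. -/
def signs (d m : ℕ) : Finset (Fin d → Bool) :=
  Finset.univ.filter fun v : Fin d → Bool => ∀ i : Fin d, m ≤ (i : ℕ) → v i = false

lemma mem_signs {m : ℕ} {v : Fin d → Bool} :
    v ∈ signs d m ↔ ∀ i : Fin d, m ≤ (i : ℕ) → v i = false := by
  simp [signs]

lemma reflect_eq_iff {m : ℕ} {x y : Fin d → ℤ} (hx : memU m x) {v : Fin d → Bool}
    (hv : v ∈ signs d m) : reflect v x = y ↔ negCoords m y = v ∧ x = fold m y := by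
  constructor
  · rintro rfl
    refine ⟨?_, by rw [fold_reflect (mem_signs.1 hv), fold_eq_self hx]⟩
    funext i
    have h1 := mem_signs.1 hv i
    have h2 := hx i
    simp only [negCoords, reflect_apply]
    by_cases hi : (i : ℕ) < m
    · have := h2 hi
      by_cases h : v i = true <;> simp [h, hi] <;> omega
    · simp [hi, h1 (not_lt.1 hi)]
  · rintro ⟨rfl, rfl⟩
    rw [fold, reflect_reflect_self]

lemma sum_signs_reflect_eq {m : ℕ} {x : Fin d → ℤ} (hx : memU m x) (y : Fin d → ℤ) :
    ∑ v ∈ signs d m, (if reflect v x = y then (1 : ℝ≥0∞) else 0)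
      = if x = fold m y then 1 else 0 := by
  have hmem : negCoords m y ∈ signs d m := mem_signs.2 (negCoords_eq_false y)
  calc _ = ∑ v ∈ signs d m, (if negCoords m y = v then (if x = fold m y then (1 : ℝ≥0∞) else 0)
        else 0) := by
        refine Finset.sum_congr rfl fun v hv => ?_
        simp only [reflect_eq_iff hx hv, ite_and]
    _ = _ := by rw [Finset.sum_ite_eq, if_pos hmem]

lemma fold_eq_of_latAdj {m : ℕ} {z w : Fin d → ℤ} (hw : memU m w) (hz : ¬ memU m z)
    (h : latAdj z w) : fold m z = w := by
  simp only [memU, not_forall, not_le] at hz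
  obtain ⟨i, hi, hneg⟩ := hz
  have hwi := hw i hi
  rw [latAdj, ← Finset.add_sum_erase _ _ (Finset.mem_univ i)] at h
  have hrest : ∑ j ∈ Finset.univ.erase i, (z j - w j).natAbs = 0 := by omega
  rw [Finset.sum_eq_zero_iff] at hrest
  funext j
  rw [fold_apply]
  by_cases hj : j = i
  · subst hj
    rw [if_pos ⟨hi, hneg⟩]
    omega
  · have h1 := hrest j (by simp [hj])
    have h2 := hw j
    split <;> omega

/-- Total conductance of the edges of `ℤ^d` joining `w` to vertices outside `U_m`. -/
def exitW (m : ℕ) (w : Fin d → ℤ) : ℝ≥0∞ := ∑' z, if memU m z then 0 else cZ d z w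

/-- Splitting a lattice neighbour sum of a folding-invariant function into its part inside `U_m`
and its boundary part. -/
lemma tsum_mul_cZ {m : ℕ} {u : (Fin d → ℤ) → ℝ≥0∞} (hu : ∀ z, u (fold m z) = u z)
    {w : Fin d → ℤ} (hw : memU m w) :
    ∑' z, u z * cZ d z w = ∑' z, u z * cU d m z w + u w * exitW m w := by
  rw [exitW, ← ENNReal.tsum_mul_left, ← ENNReal.tsum_add]
  refine tsum_congr fun z => ?_
  by_cases hz : memU m z
  · simp [hz, hw, cU, cZ]
  · by_cases h : latAdj z w
    · simp [hz, cU, cZ, ← fold_eq_of_latAdj hw hz h, hu]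
    · simp [cU, cZ, h]

lemma piW_cZ_eq {m : ℕ} {w : Fin d → ℤ} (hw : memU m w) :
    piW (cZ d) w = piW (cU d m) w + exitW m w := by
  simpa only [piW, one_mul, cZ_comm w, cU_comm m w] using
    tsum_mul_cZ (u := fun _ => 1) (fun _ => rfl) hw

lemma piW_cZ_ne_top (w : Fin d → ℤ) : piW (cZ d) w ≠ ⊤ := by
  rw [piW, tsum_eq_sum (s := Finset.Icc (fun i => w i - 1) (fun i => w i + 1))]
  · refine ENNReal.sum_ne_top.2 fun z _ => ?_
    rw [cZ]
    split <;> simp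
  · intro z hz
    rw [cZ, if_neg]
    intro h
    apply hz
    have hi : ∀ i, (w i - z i).natAbs ≤ 1 := fun i =>
      (Finset.single_le_sum (f := fun i => (w i - z i).natAbs) (fun _ _ => Nat.zero_le _)
        (Finset.mem_univ i)).trans_eq h
    rw [Finset.mem_Icc]
    constructor <;> intro i <;> have := hi i <;> simp only <;> omega

lemma piW_cU_ne_zero (hd : 0 < d) {m : ℕ} {w : Fin d → ℤ} (hw : memU m w) :
    piW (cU d m) w ≠ 0 := by
  let i₀ : Fin d := ⟨0, hd⟩
  rw [piW, Ne, ENNReal.tsum_eq_zero]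
  intro h
  have h0 := h (w + Pi.single i₀ 1)
  rw [cU, if_pos] at h0
  · exact one_ne_zero h0
  · refine ⟨hw, fun i hi => ?_, ?_⟩
    · have := hw i hi
      have h1 : (0 : Fin d → ℤ) i ≤ (Pi.single i₀ 1 : Fin d → ℤ) i :=
        (Pi.single_nonneg.2 zero_le_one : (0 : Fin d → ℤ) ≤ Pi.single i₀ 1) i
      exact add_nonneg this h1
    · simp only [latAdj, Pi.add_apply, sub_add_cancel_left, Int.natAbs_neg]
      rw [Finset.sum_eq_single i₀]
      · simp
      · intro j _ hj
        simp [hj]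
      · simp

/-- The sum of the lattice Green's functions over all reflected sources. -/
def imageSum (m : ℕ) (x z : Fin d → ℤ) : ℝ≥0∞ := ∑ v ∈ signs d m, g d (reflect v x) z

lemma imageSum_fold (m : ℕ) (x z : Fin d → ℤ) : imageSum m x (fold m z) = imageSum m x z := by
  have hn := negCoords_eq_false (m := m) z
  simp only [imageSum, fold, g_reflect, reflect_reflect]
  refine Finset.sum_nbij' (fun v i => xor (negCoords m z i) (v i))
    (fun v i => xor (negCoords m z i) (v i)) ?_ ?_ ?_ ?_ fun _ _ => rfl
  · intro v hv
    rw [mem_signs] at hv ⊢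
    intro i hi
    simp [hn i hi, hv i hi]
  · intro v hv
    rw [mem_signs] at hv ⊢
    intro i hi
    simp [hn i hi, hv i hi]
  · intro v _
    funext i
    simp
  · intro v _
    funext i
    simp

lemma piW_cU_ne_top {m : ℕ} {w : Fin d → ℤ} (hw : memU m w) : piW (cU d m) w ≠ ⊤ :=
  fun h => piW_cZ_ne_top w (by rw [piW_cZ_eq hw, h, top_add])

lemma exitW_ne_top {m : ℕ} {w : Fin d → ℤ} (hw : memU m w) : exitW m w ≠ ⊤ :=
  fun h => piW_cZ_ne_top w (by rw [piW_cZ_eq hw, h, add_top])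

lemma imageSum_le_Gm (hd : 0 < d) {m : ℕ} {x : Fin d → ℤ} (hx : memU m x) (y : Fin d → ℤ) :
    imageSum m x y ≤ Gm d m x (fold m y) := by
  refine sum_green_le (cZ d) (signs d m) (fun v => reflect v x) (fun z => Gm d m x (fold m z))
    (fun z => ?_) y
  have hw := memU_fold m z
  have hinv : ∀ t, Gm d m x (fold m (fold m t)) = Gm d m x (fold m t) := fun t => by
    rw [fold_eq_self (memU_fold m t)]
  have hsum : ∑' t, Gm d m x (fold m t) * cZ d t z
      = ∑' t, Gm d m x (fold m t) * cZ d t (fold m z) := by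
    rw [← (reflect (negCoords m z)).tsum_eq (fun t => Gm d m x (fold m t) * cZ d t (fold m z))]
    simp only [fold_reflect (negCoords_eq_false z)]
    refine tsum_congr fun t => ?_
    rw [show fold m z = reflect (negCoords m z) z from rfl, cZ_reflect]
  have hpi : piW (cZ d) z = piW (cZ d) (fold m z) := (piW_equiv _ (cZ_reflect _) z).symm
  have hU : ∑' t, Gm d m x (fold m t) * cU d m t (fold m z)
      = ∑' t, Gm d m x t * cU d m t (fold m z) := by
    refine tsum_congr fun t => ?_
    by_cases ht : memU m t
    · rw [fold_eq_self ht]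
    · simp [cU, ht]
  rw [sum_signs_reflect_eq hx, hsum, hpi, tsum_mul_cZ hinv hw, hU, ← add_assoc, piW_cZ_eq hw,
    mul_add, fold_eq_self hw]
  exact add_le_add (green_mul_piW (cU d m) x _ (piW_cU_ne_zero hd hw) (piW_cU_ne_top hw)).ge le_rfl

lemma imageSum_mul_piW (hd : 0 < d) {m : ℕ} {x w : Fin d → ℤ} (hx : memU m x) (hw : memU m w) :
    imageSum m x w * piW (cZ d) w
      = (if x = w then 1 else 0) + ∑' z, imageSum m x z * cZ d z w := by
  have h0 : piW (cZ d) w ≠ 0 := by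
    rw [piW_cZ_eq hw]
    simp [piW_cU_ne_zero hd hw]
  simp only [imageSum, Finset.sum_mul]
  rw [Summable.tsum_finsetSum fun _ _ => ENNReal.summable]
  conv_rhs => rw [← fold_eq_self hw, ← sum_signs_reflect_eq hx, fold_eq_self hw]
  rw [← Finset.sum_add_distrib]
  exact Finset.sum_congr rfl fun v _ => green_mul_piW (cZ d) _ w h0 (piW_cZ_ne_top w)

lemma Gm_le_imageSum (hd : 0 < d) {m : ℕ} {x : Fin d → ℤ} (hx : memU m x) (y : Fin d → ℤ) :
    Gm d m x y ≤ imageSum m x y := by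
  have h := sum_green_le (cU d m) {()} (fun _ => x) (imageSum m x) (fun w => ?_) y
  · rwa [Finset.sum_singleton] at h
  rw [Finset.sum_singleton]
  by_cases hw : memU m w
  · by_cases ht : imageSum m x w = ⊤
    · rw [ht, ENNReal.top_mul (piW_cU_ne_zero hd hw)]
      exact le_top
    · have h := imageSum_mul_piW hd hx hw
      rw [tsum_mul_cZ (imageSum_fold m x) hw, piW_cZ_eq hw, mul_add, ← add_assoc] at h
      exact (ENNReal.add_left_inj (ENNReal.mul_ne_top ht (exitW_ne_top hw))).1 h |>.ge
  · have hne : x ≠ w := fun h => hw (h ▸ hx)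
    simp [hne, cU, hw]

end Lattice

/-- **Green's function on `U_m = ℕ₀^m × ℤ^{d-m}`.** For `d ≥ 3`, `0 ≤ m ≤ d` and
`x, y ∈ U_m`, `G_m(x,y)` is the sum, over all `v ∈ {0,1}^m × {0}^{d-m}`, of
`g(x, z_v)` where the `i`-th coordinate of `z_v` is `y_i` if `v_i = 0` and `-y_i - 1`
if `v_i = 1`. -/
theorem green_Um (d : ℕ) (hd : 3 ≤ d) (m : ℕ) (hm : m ≤ d) (x y : Fin d → ℤ)
    (hx : memU m x) (hy : memU m y) :
    Gm d m x y
      = ∑ v ∈ Finset.univ.filter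
          (fun v : Fin d → Bool => ∀ i : Fin d, m ≤ (i : ℕ) → v i = false),
          g d x (fun i => if v i then -y i - 1 else y i) := by
  have hd0 : 0 < d := by omega
  have h : Gm d m x y = imageSum m x y := by
    refine le_antisymm (Gm_le_imageSum hd0 hx y) ?_
    simpa only [fold_eq_self hy] using imageSum_le_Gm hd0 hx y
  rw [h]
  exact Finset.sum_congr rfl fun v _ => (g_reflect v x y).symm

end
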